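/- Let E ⊆ ℝ² be closed and simply connected with induced path metric d̄, and let T ⊂ E be a simple geodesic triangle (a geodesic triangle in (E,d̄) that is a simple closed curve in ℝ²), with interior S and exterior U in ℝ². If p and q are two distinct points on a single edge A of T and the open Euclidean segment L₀ between p and q has empty intersection with T, then L₀ ⊂ U. -/

import Mathlib

open Set

noncomputable def pathLength {X : Type*} [PseudoEMetricSpace X] {x y : X} (c : Path x y) : ENNReal :=
  eVariationOn (fun t : unitInterval => c t) Set.univ

noncomputable def pathEDist {X : Type*} [PseudoEMetricSpace X] (x y : X) : ENNReal :=
  ⨅ c : Path x y, pathLength c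

/-- A unit-speed geodesic segment of the path metric `pathEDist`, parametrized on
`[0, D]`, from `x` to `y`. -/
def IsGeodesicSegment {X : Type*} [MetricSpace X] (γ : ℝ → X) (D : ℝ) (x y : X) : Prop :=
  γ 0 = x ∧ γ D = y ∧
    ∀ s ∈ Set.Icc 0 D, ∀ t ∈ Set.Icc 0 D, pathEDist (γ s) (γ t) = ENNReal.ofReal |s - t|

/-- A simple closed curve: the image of a topological circle under a continuous
injective map. -/
def IsSimpleClosedCurve {M : Type*} [TopologicalSpace M] (s : Set M) : Prop :=
  ∃ φ : Metric.sphere (0 : EuclideanSpace ℝ (Fin 2)) 1 → M,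
    Continuous φ ∧ Function.Injective φ ∧ Set.range φ = s

/-- A simple geodesic triangle in `(E, d̄)`: three vertices `p`, `q`, `r` of `E`, joined
pairwise by geodesic segments of the induced path metric on `E`, whose union is a
simple closed curve in the ambient space `M`. -/
structure SimpleGeodesicTriangle {M : Type*} [MetricSpace M] (E : Set M) where
  p : E
  q : E
  r : E
  σ : ℝ → E
  τ : ℝ → E
  ρ : ℝ → E
  a : ℝ
  b : ℝ
  c : ℝ
  ha : 0 ≤ a
  hb : 0 ≤ b
  hc : 0 ≤ c
  hσ : IsGeodesicSegment σ a p q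
  hτ : IsGeodesicSegment τ b p r
  hρ : IsGeodesicSegment ρ c q r
  simple : IsSimpleClosedCurve
    ((Subtype.val ∘ σ) '' Set.Icc 0 a ∪ (Subtype.val ∘ τ) '' Set.Icc 0 b ∪
      (Subtype.val ∘ ρ) '' Set.Icc 0 c)

namespace SimpleGeodesicTriangle

variable {M : Type*} [MetricSpace M] {E : Set M} (T : SimpleGeodesicTriangle E)

/-- The image of the triangle in the ambient space. -/
def im : Set M :=
  (Subtype.val ∘ T.σ) '' Set.Icc 0 T.a ∪ (Subtype.val ∘ T.τ) '' Set.Icc 0 T.b ∪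
    (Subtype.val ∘ T.ρ) '' Set.Icc 0 T.c

def edgePQ : Set M := (Subtype.val ∘ T.σ) '' Set.Icc 0 T.a
def edgePR : Set M := (Subtype.val ∘ T.τ) '' Set.Icc 0 T.b
def edgeQR : Set M := (Subtype.val ∘ T.ρ) '' Set.Icc 0 T.c

/-- `A` is an edge of the triangle `T`. -/
def IsEdge (A : Set M) : Prop := A = T.edgePQ ∨ A = T.edgePR ∨ A = T.edgeQR

/-- The (Jordan) interior of the simple closed curve `T`: the points of the bounded
complementary component. -/
def interior : Set M :=
  {w | w ∉ T.im ∧ Bornology.IsBounded (connectedComponentIn T.imᶜ w)}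

/-- The (Jordan) exterior of the simple closed curve `T`: the points of the unbounded
complementary component. -/
def exterior : Set M :=
  {w | w ∉ T.im ∧ ¬ Bornology.IsBounded (connectedComponentIn T.imᶜ w)}

end SimpleGeodesicTriangle

/-- A map from the circle to `ℂ \ {0}` factoring through a simply connected space has a
continuous logarithm. -/
theorem exists_continuousMap_exp_eq_of_circle {X : Type*} [TopologicalSpace X]
    [SimplyConnectedSpace X] (h : C(Circle, X)) (f : C(X, {z : ℂ // z ≠ 0})) :
    ∃ g : C(Circle, ℂ), ∀ u, Complex.exp (g u) = f (h u) := by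
  let γ : C(unitInterval, Circle) := ⟨fun t => Circle.exp (2 * Real.pi * t), by fun_prop⟩
  have hγ0 : γ 0 = 1 := by simp [γ]
  have hγ1 : γ 1 = 1 := by simp [γ]
  have hsurj : Function.Surjective γ := fun u => by
    have hmem : toIcoMod Real.two_pi_pos 0 (Complex.arg u) ∈ Ico 0 (0 + 2 * Real.pi) :=
      toIcoMod_mem_Ico _ _ _
    refine ⟨⟨toIcoMod Real.two_pi_pos 0 (Complex.arg u) / (2 * Real.pi),
      div_nonneg hmem.1 Real.two_pi_pos.le, ?_⟩, ?_⟩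
    · rw [div_le_one Real.two_pi_pos]
      linarith [hmem.2]
    · change Circle.exp (2 * Real.pi * (_ / (2 * Real.pi))) = u
      rw [mul_div_cancel₀ _ Real.two_pi_pos.ne', toIcoMod, Circle.periodic_exp.sub_zsmul_eq,
        Circle.exp_arg]
  have hquot : Topology.IsQuotientMap γ :=
    γ.continuous.isClosedMap.isQuotientMap γ.continuous hsurj
  obtain ⟨w₀, hw₀⟩ : ∃ w : ℂ, Complex.exp w = f (h 1) :=
    ⟨Complex.log (f (h 1)), Complex.exp_log (f (h 1)).2⟩
  let P : Path (h 1) (h 1) := ⟨h.comp γ, by simp [hγ0], by simp [hγ1]⟩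
  have hstart : (f.comp (P : C(unitInterval, X))) 0 =
      (fun z : ℂ => (⟨_, z.exp_ne_zero⟩ : {z : ℂ // z ≠ 0})) w₀ :=
    Subtype.ext (by simp [hw₀])
  let Γ := Complex.isCoveringMap_exp.liftPath _ w₀ hstart
  have hΓ : ∀ t, Complex.exp (Γ t) = f (h (γ t)) := fun t =>
    congrArg Subtype.val (congrFun (Complex.isCoveringMap_exp.liftPath_lifts _ w₀ hstart) t)
  have hΓ0 : Γ 0 = w₀ := Complex.isCoveringMap_exp.liftPath_zero _ w₀ hstart
  have hΓ1 : Γ 1 = w₀ := by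
    have hrefl : (f.comp ((Path.refl (h 1) : Path (h 1) (h 1)) : C(unitInterval, X))) 0 =
        (fun z : ℂ => (⟨_, z.exp_ne_zero⟩ : {z : ℂ // z ≠ 0})) w₀ :=
      Subtype.ext (by simp [hw₀])
    have h1 := Complex.isCoveringMap_exp.liftPath_apply_one_eq_of_homotopicRel
      (ContinuousMap.HomotopicRel.comp_continuousMap
        (SimplyConnectedSpace.paths_homotopic P (Path.refl (h 1))) f) w₀ hstart hrefl
    refine h1.trans ?_
    have h2 := (Complex.isCoveringMap_exp.eq_liftPath_iff' hrefl
      (Γ := ContinuousMap.const unitInterval w₀)).2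
      ⟨funext fun t => Subtype.ext (by simp [hw₀]), rfl⟩
    exact (DFunLike.congr_fun h2 1).symm
  have hfac : Function.FactorsThrough Γ γ := fun s t hst => by
    obtain ⟨m, hm⟩ := Circle.exp_eq_exp.1 hst
    have hm' : (s : ℝ) = t + m := by
      have := Real.two_pi_pos
      have h3 : 2 * Real.pi * (s : ℝ) = 2 * Real.pi * (t + m) := by rw [hm]; ring
      exact mul_left_cancel₀ this.ne' h3
    have hs := s.2
    have ht := t.2
    have hm1 : m ≤ 1 := by
      have : (m : ℝ) ≤ 1 := by linarith [hs.2, ht.1]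
      exact_mod_cast this
    have hm2 : -1 ≤ m := by
      have : (-1 : ℝ) ≤ m := by linarith [hs.1, ht.2]
      exact_mod_cast this
    interval_cases m
    · have h4 : s = 0 := Subtype.ext (by push_cast at hm' ⊢; linarith [hs.1, ht.2])
      have h5 : t = 1 := Subtype.ext (by push_cast at hm' ⊢; linarith [hs.1, ht.2])
      rw [h4, h5, hΓ0, hΓ1]
    · have h4 : s = t := Subtype.ext (by simpa using hm')
      rw [h4]
    · have h4 : s = 1 := Subtype.ext (by push_cast at hm' ⊢; linarith [hs.2, ht.1])
      have h5 : t = 0 := Subtype.ext (by push_cast at hm' ⊢; linarith [hs.2, ht.1])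
      rw [h4, h5, hΓ0, hΓ1]
  refine ⟨hquot.lift Γ hfac, fun u => ?_⟩
  obtain ⟨t, rfl⟩ := hsurj u
  rw [← hΓ t]
  congr 1
  exact DFunLike.congr_fun (hquot.lift_comp Γ hfac) t

theorem frontier_connectedComponentIn_compl_subset {X : Type*} [TopologicalSpace X]
    [LocallyConnectedSpace X] {K : Set X} (hK : IsClosed K) {z : X} (hz : z ∉ K) :
    frontier (connectedComponentIn Kᶜ z) ⊆ K := by
  intro x hx
  by_contra hxK
  have hopen : IsOpen (connectedComponentIn Kᶜ z) := hK.isOpen_compl.connectedComponentIn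
  rw [hopen.frontier_eq] at hx
  have hpre : IsPreconnected (insert x (connectedComponentIn Kᶜ z)) :=
    isPreconnected_connectedComponentIn.subset_closure (subset_insert _ _)
      (insert_subset hx.1 subset_closure)
  exact hx.2 (hpre.subset_connectedComponentIn (mem_insert_of_mem _ (mem_connectedComponentIn hz))
    (insert_subset hxK (connectedComponentIn_subset _ _)) (mem_insert _ _))

/-- If `x ↦ x - z` has a continuous logarithm on a closed plane set `K`, then `z` lies in an
unbounded component of the complement of `K`. -/
theorem not_isBounded_connectedComponentIn_of_exp_eq {V : Type*} [NormedAddCommGroup V]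
    [NormedSpace ℝ V] (e : V ≃ₗᵢ[ℝ] ℂ) {K : Set V} (hK : IsClosed K) {z : V} (hz : z ∉ K)
    (g : C(K, ℂ)) (hg : ∀ x : K, Complex.exp (g x) = e (x - z)) :
    ¬ Bornology.IsBounded (connectedComponentIn Kᶜ z) := by
  classical
  intro hb
  set C := connectedComponentIn Kᶜ z
  have hzC : z ∈ C := mem_connectedComponentIn hz
  obtain ⟨G, hG⟩ := g.exists_restrict_eq hK
  have hcont : Continuous (C.piecewise (fun x => Complex.exp (G x)) fun x => e (x - z)) := by
    refine Continuous.piecewise (fun a ha => ?_) (by fun_prop) (by fun_prop)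
    have haK := frontier_connectedComponentIn_compl_subset hK hz ha
    rw [← hg ⟨a, haK⟩, ← hG]
    rfl
  have hne : ∀ x, C.piecewise (fun x => Complex.exp (G x)) (fun x => e (x - z)) x ≠ 0 := by
    intro x
    by_cases hx : x ∈ C
    · simp [hx]
    · simp only [hx, not_false_eq_true, piecewise_eq_of_notMem, ne_eq,
        EmbeddingLike.map_eq_zero_iff, sub_eq_zero]
      rintro rfl
      exact hx hzC
  let F : C(V, {w : ℂ // w ≠ 0}) := ⟨fun x => ⟨_, hne x⟩, by fun_prop⟩
  obtain ⟨L, ⟨-, hL⟩, -⟩ := Complex.isCoveringMap_exp.existsUnique_continuousMap_lifts F z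
    (Complex.log (F z)) (Subtype.ext (Complex.exp_log (F z).2))
  have hL' : ∀ x, x ∉ C → Complex.exp (L x) = e (x - z) := fun x hx =>
    by
    refine (congrArg Subtype.val (congrFun hL x)).trans ?_
    simp [F, hx]
  obtain ⟨R, hR0, hR⟩ := hb.subset_ball_lt 0 z
  let c : ℝ → V := fun θ => z + e.symm (R * Complex.exp (θ * Complex.I))
  have hcC : ∀ θ, c θ ∉ C := fun θ hθ => by
    have := hR hθ
    simp [c, Complex.norm_exp_ofReal_mul_I, abs_of_pos hR0] at this
  have hLc : ∀ θ, Complex.exp (L (c θ)) = R * Complex.exp (θ * Complex.I) := fun θ => by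
    rw [hL' _ (hcC θ)]
    simp [c]
  have heq : (fun θ : ℝ => L (c θ)) = fun θ : ℝ => L (c 0) + θ * Complex.I := by
    refine Complex.isCoveringMap_exp.eq_of_comp_eq (by fun_prop) (by fun_prop)
      (funext fun θ => Subtype.ext ?_) 0 (by simp)
    simp [Complex.exp_add, hLc]
  have h2 := congrFun heq (2 * Real.pi)
  have hper : c (2 * Real.pi) = c 0 := by simp [c, Complex.exp_two_pi_mul_I]
  simp [hper, Real.pi_ne_zero] at h2

/-- A closed, simply connected plane set contains the bounded complementary components of every
simple closed curve it contains. -/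
theorem IsSimpleClosedCurve.mem_of_isBounded_connectedComponentIn
    {E K : Set (EuclideanSpace ℝ (Fin 2))} [SimplyConnectedSpace E] (hK : IsSimpleClosedCurve K)
    (hKE : K ⊆ E) {z : EuclideanSpace ℝ (Fin 2)}
    (hb : Bornology.IsBounded (connectedComponentIn Kᶜ z)) : z ∈ E := by
  by_contra hzE
  obtain ⟨φ, hφ, hinj, rfl⟩ := hK
  let e := Complex.orthonormalBasisOneI.repr
  let j : Circle → Metric.sphere (0 : EuclideanSpace ℝ (Fin 2)) 1 := fun u => ⟨e u, by simp [Circle.norm_coe u]⟩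
  let k : Metric.sphere (0 : EuclideanSpace ℝ (Fin 2)) 1 → Circle := fun v =>
    ⟨e.symm v, by simp [Submonoid.unitSphere]⟩
  have hj : Continuous j := by fun_prop
  have hk : Continuous k := by fun_prop
  have hjk : ∀ v, j (k v) = v := fun v => Subtype.ext (by simp [j, k])
  let h : C(Circle, E) := ⟨fun u => ⟨φ (j u), hKE (mem_range_self _)⟩, by fun_prop⟩
  let f : C(E, {w : ℂ // w ≠ 0}) := ⟨fun x => ⟨e.symm (x - z), by
    simpa [sub_eq_zero] using fun hx : (x : EuclideanSpace ℝ (Fin 2)) = z => hzE (hx ▸ x.2)⟩,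
    by fun_prop⟩
  obtain ⟨g, hg⟩ := exists_continuousMap_exp_eq_of_circle h f
  have hemb : Topology.IsEmbedding φ := (hφ.isClosedEmbedding hinj).isEmbedding
  let ψ := hemb.toHomeomorph
  refine not_isBounded_connectedComponentIn_of_exp_eq e.symm
    (isCompact_range hφ).isClosed (fun hz => hzE (hKE hz))
    ⟨fun x => g (k (ψ.symm x)), by fun_prop⟩ (fun x => ?_) hb
  obtain ⟨v, rfl⟩ := ψ.surjective x
  simp [hg, h, f, hjk, ψ]

theorem edist_le_pathEDist {X : Type*} [PseudoEMetricSpace X] (x y : X) :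
    edist x y ≤ pathEDist x y := by
  refine le_iInf fun c => ?_
  simpa using! eVariationOn.edist_le (fun t : unitInterval => c t) (mem_univ 0) (mem_univ 1)

theorem pathEDist_le_of_segment_subset {V : Type*} [NormedAddCommGroup V] [NormedSpace ℝ V]
    {E : Set V} {x y : E} (h : segment ℝ (x : V) y ⊆ E) : pathEDist x y ≤ edist x y := by
  have hmem : ∀ t : unitInterval, AffineMap.lineMap (x : V) (y : V) (t : ℝ) ∈ E := fun t =>
    h (by rw [segment_eq_image_lineMap]; exact mem_image_of_mem _ t.2)
  let c : Path x y :=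
    { toFun := fun t => ⟨AffineMap.lineMap (x : V) (y : V) (t : ℝ), hmem t⟩
      continuous_toFun := by fun_prop
      source' := by simp
      target' := by simp }
  refine (iInf_le _ c).trans ?_
  have hlip : LipschitzWith (nndist (x : V) y) (AffineMap.lineMap (x : V) (y : V) : ℝ → V) :=
    lipschitzWith_lineMap _ _
  have hval : eVariationOn (fun t : unitInterval => (t : ℝ)) univ ≤ 1 := by
    have hmono : MonotoneOn (fun t : unitInterval => (t : ℝ)) univ := fun _ _ _ _ hab => hab
    have huniv : Icc (0 : unitInterval) 1 = univ := Icc_bot_top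
    simpa [huniv] using (hmono.eVariationOn_eq (mem_univ 0) (mem_univ 1)).le
  calc pathLength c = eVariationOn ((AffineMap.lineMap (x : V) (y : V) : ℝ → V) ∘
        fun t : unitInterval => (t : ℝ)) univ := rfl
    _ ≤ nndist (x : V) y * eVariationOn (fun t : unitInterval => (t : ℝ)) univ :=
      (hlip.lipschitzOnWith (s := univ)).comp_eVariationOn_le (mapsTo_univ _ _)
    _ ≤ nndist (x : V) y * 1 := by gcongr
    _ = edist x y := by rw [mul_one, ← edist_nndist, Subtype.edist_eq]

/-- A geodesic segment of the path metric of `E` through two points whose Euclidean segment lies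
in `E` meets the open segment between them. -/
theorem IsGeodesicSegment.openSegment_inter_nonempty {V : Type*} [NormedAddCommGroup V]
    [NormedSpace ℝ V] [StrictConvexSpace ℝ V] {E : Set V} {γ : ℝ → E} {D : ℝ} {x y : E}
    (hγ : IsGeodesicSegment γ D x y) {s t : ℝ} (hs : s ∈ Icc 0 D) (ht : t ∈ Icc 0 D)
    (hne : (γ s : V) ≠ γ t) (hE : segment ℝ (γ s : V) (γ t) ⊆ E) :
    (openSegment ℝ (γ s : V) (γ t) ∩ (Subtype.val ∘ γ) '' Icc 0 D).Nonempty := by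
  wlog hst : s ≤ t generalizing s t
  · rw [openSegment_symm]
    exact this ht hs hne.symm (by rwa [segment_symm]) (le_of_not_ge hst)
  obtain ⟨-, -, hγ⟩ := hγ
  have hle : ∀ u ∈ Icc 0 D, ∀ v ∈ Icc 0 D, dist (γ u : V) (γ v) ≤ |u - v| := by
    intro u hu v hv
    have := (edist_le_pathEDist (γ u) (γ v)).trans_eq (hγ u hu v hv)
    rw [edist_dist] at this
    exact (ENNReal.ofReal_le_ofReal_iff (abs_nonneg _)).1 this
  have hge : t - s ≤ dist (γ s : V) (γ t) := by
    have := (hγ s hs t ht).symm.trans_le (pathEDist_le_of_segment_subset hE)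
    rw [edist_dist] at this
    have := (ENNReal.ofReal_le_ofReal_iff dist_nonneg).1 this
    rw [abs_sub_comm] at this
    exact (le_abs_self _).trans this
  have hpos := dist_pos.2 hne
  have hm : (s + t) / 2 ∈ Icc 0 D :=
    ⟨by linarith [hs.1, ht.1], by linarith [hs.2, ht.2]⟩
  have h0 := hle s hs t ht
  have h1 := hle s hs _ hm
  have h2 := hle _ hm t ht
  rw [abs_of_nonpos (by linarith)] at h0 h1 h2
  have htri := dist_triangle (γ s : V) (γ ((s + t) / 2)) (γ t)
  have hw : Wbtw ℝ (γ s : V) (γ ((s + t) / 2)) (γ t) :=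
    dist_add_dist_eq_iff.1 (by linarith)
  refine ⟨_, mem_openSegment_of_ne_left_right (𝕜 := ℝ) ?_ ?_ hw.mem_segment, mem_image_of_mem _ hm⟩
  · rw [← dist_pos]; linarith
  · rw [← dist_pos, dist_comm]; linarith

theorem SimpleGeodesicTriangle.im_subset {M : Type*} [MetricSpace M] {E : Set M}
    (T : SimpleGeodesicTriangle E) : T.im ⊆ E := by
  rintro _ ((⟨t, -, rfl⟩ | ⟨t, -, rfl⟩) | ⟨t, -, rfl⟩) <;> exact Subtype.coe_prop _

theorem SimpleGeodesicTriangle.IsEdge.exists_isGeodesicSegment {M : Type*} [MetricSpace M]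
    {E : Set M} {T : SimpleGeodesicTriangle E} {A : Set M} (hA : T.IsEdge A) :
    A ⊆ T.im ∧ ∃ (γ : ℝ → E) (D : ℝ) (x y : E), IsGeodesicSegment γ D x y ∧
      A = (Subtype.val ∘ γ) '' Icc 0 D := by
  rcases hA with rfl | rfl | rfl
  · exact ⟨fun _ h => .inl (.inl h), _, _, _, _, T.hσ, rfl⟩
  · exact ⟨fun _ h => .inl (.inr h), _, _, _, _, T.hτ, rfl⟩
  · exact ⟨fun _ h => .inr h, _, _, _, _, T.hρ, rfl⟩

/-- If `p`, `q` are distinct points on a single edge `A` of a simple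
geodesic triangle `T` in a closed, simply connected, rectifiably path-connected
`E ⊆ ℝ²`, and the open Euclidean segment between them misses `T`, then that open
segment lies in the Jordan exterior of `T`. -/
theorem segment_in_exterior (E : Set (EuclideanSpace ℝ (Fin 2)))
    (hclosed : IsClosed E) (hsc : SimplyConnectedSpace E)
    (hrect : ∀ x y : E, pathEDist x y ≠ ⊤)
    (T : SimpleGeodesicTriangle E) (A : Set (EuclideanSpace ℝ (Fin 2)))
    (hA : T.IsEdge A) (p q : EuclideanSpace ℝ (Fin 2))
    (hp : p ∈ A) (hq : q ∈ A) (hpq : p ≠ q)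
    (hmiss : openSegment ℝ p q ∩ T.im = ∅) :
    openSegment ℝ p q ⊆ T.exterior := by
  obtain ⟨hAT, γ, D, x, y, hγ, rfl⟩ := hA.exists_isGeodesicSegment
  obtain ⟨s, hs, rfl⟩ := hp
  obtain ⟨t, ht, rfl⟩ := hq
  have hdisj := disjoint_iff_inter_eq_empty.2 hmiss
  intro w hw
  refine ⟨hdisj.notMem_of_mem_left hw, fun hb => ?_⟩
  have hsub := (convex_openSegment _ _).isPreconnected.subset_connectedComponentIn hw
    hdisj.subset_compl_right
  have hE : segment ℝ (γ s : EuclideanSpace ℝ (Fin 2)) (γ t) ⊆ E := by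
    rw [← insert_endpoints_openSegment]
    refine insert_subset (γ s).2 (insert_subset (γ t).2 fun v hv => ?_)
    refine IsSimpleClosedCurve.mem_of_isBounded_connectedComponentIn T.simple T.im_subset (z := v) ?_
    exact connectedComponentIn_eq (hsub hv) ▸ hb
  obtain ⟨v, hv, hvA⟩ := hγ.openSegment_inter_nonempty hs ht hpq hE
  exact hdisj.notMem_of_mem_left hv (hAT hvA)
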